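/- (Main theorem.) Assume a > 0 and |b| > a + 1, and let Ω be a nonempty bounded open subset of ℝ² whose topological frontier equals C. Then the homogeneous Dirichlet problem for the string equation on Ω has a nontrivial solution if and only if the John map T is periodic on C, i.e., there exists an integer N ≥ 1 with T^N(p) = p for all p ∈ C. -/

import Mathlib

/-- The Euler–Baxter curve. -/
def EBcurve (a b : ℝ) : Set (ℝ × ℝ) :=
  {p : ℝ × ℝ | p.1 ^ 2 * p.2 ^ 2 + 1 + a * (p.1 ^ 2 + p.2 ^ 2) + 2 * b * p.1 * p.2 = 0}

/-- The John map `T = I₂ ∘ I₁` built from the two John involutions. -/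
noncomputable def johnMap (a b : ℝ) : ℝ × ℝ → ℝ × ℝ :=
  (fun q : ℝ × ℝ => (-2 * b * q.2 / (q.2 ^ 2 + a) - q.1, q.2)) ∘
    (fun q : ℝ × ℝ => (q.1, -2 * b * q.1 / (q.1 ^ 2 + a) - q.2))

/-- A solution of the homogeneous Dirichlet problem for the string equation on `Ω`:
continuous on the closure of `Ω`, twice continuously differentiable on `Ω`,
satisfying `∂²Φ/∂x∂y = 0` on `Ω`, and vanishing on the curve `C`. -/
def IsDirichletSolution (a b : ℝ) (Ω : Set (ℝ × ℝ)) (Φ : ℝ × ℝ → ℝ) : Prop :=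
  ContinuousOn Φ (closure Ω) ∧ ContDiffOn ℝ 2 Φ Ω ∧
    (∀ p ∈ Ω, deriv (fun x : ℝ => deriv (fun y : ℝ => Φ (x, y)) p.2) p.1 = 0) ∧
    ∀ p ∈ EBcurve a b, Φ p = 0



lemma time_change (w : ℝ → ℝ) (hw : Continuous w) (hpos : ∀ x, 0 < w x)
    (hper : ∀ x, w (x + 2 * Real.pi) = w x) :
    ∃ (th : ℝ → ℝ) (P : ℝ), 0 < P ∧ (∀ t, HasDerivAt th (w (th t)) t) ∧
      (∀ t, th (t + P) = th t + 2 * Real.pi) ∧ Function.Bijective th := by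
  set g : ℝ → ℝ := fun x => (w x)⁻¹ with hg
  have hgc : Continuous g := hw.inv₀ (fun x => (hpos x).ne')
  have hgp : ∀ x, 0 < g x := fun x => inv_pos.2 (hpos x)
  have hgper : Function.Periodic g (2 * Real.pi) := fun x => by simp [hg, hper]
  set S : ℝ → ℝ := fun x => ∫ s in (0:ℝ)..x, g s with hS
  have hSd : ∀ x, HasDerivAt S (g x) x := fun x =>
    intervalIntegral.integral_hasDerivAt_right (hgc.intervalIntegrable _ _)
      hgc.stronglyMeasurable.stronglyMeasurableAtFilter hgc.continuousAt
  have hmono : StrictMono S := strictMono_of_deriv_pos fun x => by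
    rw [(hSd x).deriv]; exact hgp x
  have hcont : Continuous S := continuous_iff_continuousAt.2 fun x => (hSd x).continuousAt
  have hS0 : S 0 = 0 := by simp [hS]
  have hadd : ∀ x, S (x + 2 * Real.pi) = S x + S (2 * Real.pi) := by
    intro x
    have h1 := intervalIntegral.integral_add_adjacent_intervals
      (hgc.intervalIntegrable (μ := MeasureTheory.volume) 0 x)
      (hgc.intervalIntegrable x (x + 2 * Real.pi))
    have h2 := hgper.intervalIntegral_add_eq x 0
    simp only [zero_add] at h2
    simp only [hS]
    rw [← h1, h2]
  set P := S (2 * Real.pi) with hP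
  have hPpos : 0 < P := by
    rw [← hS0]; exact hmono Real.two_pi_pos
  have hmul : ∀ n : ℕ, S (n * (2 * Real.pi)) = n * P := by
    intro n
    induction n with
    | zero => simp [hS0]
    | succ k ih =>
      push_cast
      rw [add_mul, one_mul, hadd, ih]; ring
  have hmul' : ∀ n : ℕ, S (-(n * (2 * Real.pi))) = -(n * P) := by
    intro n
    induction n with
    | zero => simp [hS0]
    | succ k ih =>
      have := hadd (-((k+1:ℕ) * (2 * Real.pi)))
      have e : -((k+1:ℕ) * (2 * Real.pi)) + 2 * Real.pi = -(k * (2 * Real.pi)) := by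
        push_cast; ring
      rw [e, ih] at this
      push_cast at this ⊢
      linarith
  have hsurj : Function.Surjective S := by
    intro y
    obtain ⟨n, hn⟩ := exists_nat_ge (|y| / P)
    have hn' : |y| ≤ n * P := by rwa [div_le_iff₀ hPpos] at hn
    have hle : -((n:ℝ) * (2 * Real.pi)) ≤ n * (2 * Real.pi) := by
      have : 0 ≤ (n:ℝ) * (2 * Real.pi) := by positivity
      linarith
    have := intermediate_value_Icc hle hcont.continuousOn
    rw [hmul, hmul'] at this
    obtain ⟨x, -, hx⟩ := this (abs_le.1 hn')
    exact ⟨x, hx⟩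
  let e := StrictMono.orderIsoOfSurjective S hmono hsurj
  have he : ∀ x, e x = S x := fun x => rfl
  refine ⟨e.symm, P, hPpos, ?_, ?_, e.symm.bijective⟩
  · intro t
    have hc : ContinuousAt e.symm t := e.symm.continuous.continuousAt
    have := HasDerivAt.of_local_left_inverse (f := S) (f' := g (e.symm t)) hc (hSd _)
      (hgp _).ne' (Filter.Eventually.of_forall fun y => by rw [← he]; simp)
    simpa [hg] using this
  · intro t
    apply e.injective
    have h1 : ∀ y, S (e.symm y) = y := fun y => e.apply_symm_apply y
    rw [he, he, hadd, h1, h1]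


def FF (a b x y : ℝ) : ℝ := x ^ 2 * y ^ 2 + 1 + a * (x ^ 2 + y ^ 2) + 2 * b * x * y
def FY (a b x y : ℝ) : ℝ := 2 * x ^ 2 * y + 2 * a * y + 2 * b * x
def FX (a b x y : ℝ) : ℝ := 2 * x * y ^ 2 + 2 * a * x + 2 * b * y

/-- Hamiltonian-time parametrization of the part of the curve in `x > 0`. -/
structure Par (a b P : ℝ) (X Y : ℝ → ℝ) : Prop where
  Ppos : 0 < P
  pos : ∀ t, 0 < X t
  on : ∀ t, FF a b (X t) (Y t) = 0
  dX : ∀ t, HasDerivAt X (FY a b (X t) (Y t)) t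
  dY : ∀ t, HasDerivAt Y (-FX a b (X t) (Y t)) t
  surj : ∀ x y, 0 < x → FF a b x y = 0 → ∃ t, X t = x ∧ Y t = y
  inj : ∀ s t, X s = X t → Y s = Y t → ∃ n : ℤ, s = t + n * P
  perX : ∀ t, X (t + P) = X t
  perY : ∀ t, Y (t + P) = Y t

lemma exists_angle (c s : ℝ) (h : c ^ 2 + s ^ 2 = 1) : ∃ t, Real.cos t = c ∧ Real.sin t = s := by
  have hn : ‖(⟨c, s⟩ : ℂ)‖ = 1 := by
    rw [Complex.norm_eq_sqrt_sq_add_sq]; simp [h]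
  refine ⟨Complex.arg ⟨c, s⟩, ?_, ?_⟩
  · rw [Complex.cos_arg (by intro h0; simp [h0] at hn), hn]; simp
  · rw [Complex.sin_arg, hn]; simp

lemma F_expr (a b e d : ℝ) :
    FF a b (Real.exp (e + d)) (Real.exp (e - d)) = Real.exp (2 * e) *
      (2 + 4 * Real.sinh e ^ 2 + a * (2 + 4 * Real.sinh d ^ 2) + 2 * b) := by
  have he := Real.exp_pos e
  have hd := Real.exp_pos d
  have h2 : Real.exp (2 * e) = Real.exp e ^ 2 := by rw [← Real.exp_nat_mul]; norm_num
  simp only [FF, Real.sinh_eq, Real.exp_add, Real.exp_sub, Real.exp_neg, h2]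
  field_simp
  ring

lemma FY_expr (a b e d : ℝ) (h : FF a b (Real.exp (e + d)) (Real.exp (e - d)) = 0) :
    FY a b (Real.exp (e + d)) (Real.exp (e - d)) = Real.exp (e + d) *
      (4 * Real.sinh e * Real.cosh e - 4 * a * Real.sinh d * Real.cosh d) := by
  have he := Real.exp_pos e
  have hd := Real.exp_pos d
  simp only [FF, FY, Real.sinh_eq, Real.cosh_eq, Real.exp_add, Real.exp_sub, Real.exp_neg] at h ⊢
  field_simp at h ⊢
  linear_combination 4 * h

lemma FX_expr (a b e d : ℝ) (h : FF a b (Real.exp (e + d)) (Real.exp (e - d)) = 0) :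
    FX a b (Real.exp (e + d)) (Real.exp (e - d)) = Real.exp (e - d) *
      (4 * Real.sinh e * Real.cosh e + 4 * a * Real.sinh d * Real.cosh d) := by
  have he := Real.exp_pos e
  have hd := Real.exp_pos d
  simp only [FF, FX, Real.sinh_eq, Real.cosh_eq, Real.exp_add, Real.exp_sub, Real.exp_neg] at h ⊢
  field_simp at h ⊢
  linear_combination 4 * h

lemma exists_par_neg (a b : ℝ) (ha : 0 < a) (hb : b < -(a + 1)) :
    ∃ P X Y, Par a b P X Y := by
  set k : ℝ := (-b - 1 - a) / 2 with hk
  have hkpos : 0 < k := by rw [hk]; linarith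
  obtain ⟨s, hs, hs2⟩ : ∃ s : ℝ, 0 < s ∧ s ^ 2 = a := ⟨√a, Real.sqrt_pos.2 ha, Real.sq_sqrt ha.le⟩
  obtain ⟨B, hB, hB2⟩ : ∃ s : ℝ, 0 < s ∧ s ^ 2 = k / a :=
    ⟨√(k / a), Real.sqrt_pos.2 (by positivity), Real.sq_sqrt (by positivity)⟩
  have hB2' : a * B ^ 2 = k := by rw [hB2]; field_simp
  set E : ℝ → ℝ := fun th => Real.arsinh (s * B * Real.cos th) with hE
  set D : ℝ → ℝ := fun th => Real.arsinh (B * Real.sin th) with hD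
  have hEs : ∀ th, Real.sinh (E th) = s * B * Real.cos th := fun th => Real.sinh_arsinh _
  have hDs : ∀ th, Real.sinh (D th) = B * Real.sin th := fun th => Real.sinh_arsinh _
  have hE2 : ∀ x, E (x + 2 * Real.pi) = E x := fun x => by simp [hE]
  have hD2 : ∀ x, D (x + 2 * Real.pi) = D x := fun x => by simp [hD]
  set w : ℝ → ℝ := fun th => 4 * s * Real.cosh (E th) * Real.cosh (D th) with hw
  obtain ⟨th, P, hP, hth, hthP, hbij⟩ := time_change w
    (by
      have h1 : Continuous E := Real.continuous_arsinh.comp (by fun_prop)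
      have h2 : Continuous D := Real.continuous_arsinh.comp (by fun_prop)
      have h3 := Real.continuous_cosh
      fun_prop)
    (fun x => by
      have := Real.cosh_pos (E x); have := Real.cosh_pos (D x); simp only [hw]; positivity)
    (fun x => by simp only [hw, hE2, hD2])
  have dE : ∀ t, HasDerivAt (fun t => E (th t))
      (-(4 * a * Real.sinh (D (th t)) * Real.cosh (D (th t)))) t := by
    intro t
    have h := (((Real.hasDerivAt_cos (th t)).comp t (hth t)).const_mul (s * B)).arsinh
    refine HasDerivAt.congr_deriv h ?_
    symm
    have hc : √(1 + (s * B * (Real.cos ∘ th) t) ^ 2) = Real.cosh (E (th t)) :=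
      (Real.cosh_arsinh _).symm
    have := Real.cosh_pos (E (th t))
    rw [hc, hDs]
    simp only [hw, smul_eq_mul, ← hs2]
    field_simp
  have dD : ∀ t, HasDerivAt (fun t => D (th t))
      (4 * Real.sinh (E (th t)) * Real.cosh (E (th t))) t := by
    intro t
    have h := (((Real.hasDerivAt_sin (th t)).comp t (hth t)).const_mul B).arsinh
    refine HasDerivAt.congr_deriv h ?_
    symm
    have hc : √(1 + (B * (Real.sin ∘ th) t) ^ 2) = Real.cosh (D (th t)) :=
      (Real.cosh_arsinh _).symm
    have := Real.cosh_pos (D (th t))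
    rw [hc, hEs]
    simp only [hw, smul_eq_mul]
    field_simp
  have hon : ∀ t, FF a b (Real.exp (E (th t) + D (th t))) (Real.exp (E (th t) - D (th t))) = 0 := by
    intro t
    rw [F_expr, hEs, hDs]
    have h1 := Real.sin_sq_add_cos_sq (th t)
    have : 2 + 4 * (s * B * Real.cos (th t)) ^ 2 + a * (2 + 4 * (B * Real.sin (th t)) ^ 2) + 2 * b
        = 0 := by
      have : (s * B * Real.cos (th t)) ^ 2 = k * Real.cos (th t) ^ 2 := by
        rw [← hB2', ← hs2]; ring
      rw [this]
      linear_combination (4 * Real.sin (th t) ^ 2) * hB2' + 4 * k * h1 + 4 * hk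
    rw [this, mul_zero]
  refine ⟨P, fun t => Real.exp (E (th t) + D (th t)), fun t => Real.exp (E (th t) - D (th t)),
    hP, fun t => Real.exp_pos _, hon, ?_, ?_, ?_, ?_, ?_, ?_⟩
  · intro t
    simp only [FY_expr a b _ _ (hon t)]
    refine HasDerivAt.congr_deriv ((dE t).add (dD t)).exp ?_
    change Real.exp (E (th t) + D (th t)) * _ = _
    ring
  · intro t
    simp only [FX_expr a b _ _ (hon t)]
    refine HasDerivAt.congr_deriv ((dE t).sub (dD t)).exp ?_
    change Real.exp (E (th t) - D (th t)) * _ = _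
    ring
  · intro x y hx hF
    have hy : 0 < y := by
      by_contra hy
      push Not at hy
      have : FF a b x y > 0 := by
        have : 0 ≤ -b * x * (-y) := mul_nonneg (mul_nonneg (by linarith) hx.le) (by linarith)
        simp only [FF]
        nlinarith [sq_nonneg (x * y), sq_nonneg x, sq_nonneg y, mul_nonneg ha.le (sq_nonneg x),
          mul_nonneg ha.le (sq_nonneg y)]
      linarith
    set e := (Real.log x + Real.log y) / 2 with he
    set d := (Real.log x - Real.log y) / 2 with hd
    have hex : Real.exp (e + d) = x := by
      rw [he, hd]; ring_nf; exact Real.exp_log hx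
    have hey : Real.exp (e - d) = y := by
      rw [he, hd]; ring_nf; exact Real.exp_log hy
    have h1 := F_expr a b e d
    rw [hex, hey, hF] at h1
    have h2 := (mul_eq_zero.1 h1.symm).resolve_left (Real.exp_pos _).ne'
    obtain ⟨u, hu1, hu2⟩ := exists_angle (Real.sinh e / (s * B)) (Real.sinh d / B) (by
      rw [div_pow, div_pow, mul_pow, hs2]
      have hB0 : B ^ 2 ≠ 0 := by positivity
      field_simp
      linear_combination h2 / 4 - hB2' + hk)
    obtain ⟨t, rfl⟩ := hbij.2 u
    have e1 : E (th t) = e := by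
      apply Real.sinh_injective; rw [hEs, hu1]; field_simp
    have e2 : D (th t) = d := by
      apply Real.sinh_injective; rw [hDs, hu2]; field_simp
    exact ⟨t, by simp only [e1, e2, hex], by simp only [e1, e2, hey]⟩
  · intro u t h1 h2
    have h1 := Real.exp_injective h1
    have h2 := Real.exp_injective h2
    have e1 : E (th u) = E (th t) := by linarith
    have e2 : D (th u) = D (th t) := by linarith
    have e1 := congrArg Real.sinh e1
    have e2 := congrArg Real.sinh e2
    rw [hEs, hEs] at e1
    rw [hDs, hDs] at e2
    have e1 := mul_left_cancel₀ (by positivity) e1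
    have e2 := mul_left_cancel₀ (by positivity) e2
    have := Real.Angle.cos_sin_inj e1 e2
    rw [Real.Angle.angle_eq_iff_two_pi_dvd_sub] at this
    obtain ⟨n, hn⟩ := this
    have hnat : ∀ (m : ℕ) t, th (t + m * P) = th t + 2 * Real.pi * m := by
      intro m t
      induction m with
      | zero => simp
      | succ k ih =>
        push_cast
        rw [show t + (k + 1) * P = (t + k * P) + P by ring, hthP, ih]; ring
    refine ⟨n, hbij.1 ?_⟩
    rcases Int.eq_nat_or_neg n with ⟨m, rfl | rfl⟩
    · have := hnat m t
      push_cast at hn ⊢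
      rw [this]; linarith
    · have := hnat m (t + (-m) * P)
      rw [show t + (-m) * P + m * P = t by ring] at this
      push_cast at hn ⊢
      linarith
  · intro t; simp only [hthP, hE2, hD2]
  · intro t; simp only [hthP, hE2, hD2]

lemma exists_par (a b : ℝ) (ha : 0 < a) (hb : a + 1 < |b|) : ∃ P X Y, Par a b P X Y := by
  rcases lt_or_ge b 0 with h | h
  · rw [abs_of_neg h] at hb
    exact exists_par_neg a b ha (by linarith)
  · rw [abs_of_nonneg h] at hb
    obtain ⟨P, X, Y, hp⟩ := exists_par_neg a (-b) ha (by linarith)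
    refine ⟨P, fun t => X (-t), fun t => -Y (-t), hp.Ppos, fun t => hp.pos _, ?_, ?_, ?_, ?_, ?_, ?_, ?_⟩
    · intro t; have := hp.on (-t); simp only [FF] at *; linarith
    · intro t
      have := (hp.dX (-t)).scomp t (hasDerivAt_neg t)
      refine HasDerivAt.congr_deriv this ?_
      simp only [FY, smul_eq_mul]; ring
    · intro t
      have := ((hp.dY (-t)).scomp t (hasDerivAt_neg t)).neg
      refine HasDerivAt.congr_deriv this ?_
      simp only [FX, smul_eq_mul]; ring
    · intro x y hx hF
      obtain ⟨t, h1, h2⟩ := hp.surj x (-y) hx (by simp only [FF] at *; linarith)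
      exact ⟨-t, by simp [h1], by simp [h2]⟩
    · intro u t h1 h2
      obtain ⟨n, hn⟩ := hp.inj (-u) (-t) h1 (by simpa using h2)
      exact ⟨-n, by push_cast; linarith⟩
    · intro t
      have := hp.perX (-(t + P)); rw [show -(t + P) + P = -t by ring] at this; exact this.symm
    · intro t
      have := hp.perY (-(t + P)); rw [show -(t + P) + P = -t by ring] at this; simp only [this]


lemma Par.contX {a b P X Y} (hp : Par a b P X Y) : Continuous X :=
  continuous_iff_continuousAt.2 fun t => (hp.dX t).continuousAt

lemma Par.contY {a b P X Y} (hp : Par a b P X Y) : Continuous Y :=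
  continuous_iff_continuousAt.2 fun t => (hp.dY t).continuousAt

lemma Par.perXn {a b P X Y} (hp : Par a b P X Y) (n : ℤ) (t : ℝ) : X (t + n * P) = X t :=
  Function.Periodic.int_mul hp.perX n t

lemma Par.perYn {a b P X Y} (hp : Par a b P X Y) (n : ℤ) (t : ℝ) : Y (t + n * P) = Y t :=
  Function.Periodic.int_mul hp.perY n t

lemma exists_Icc_rep {P : ℝ} (hP : 0 < P) (t : ℝ) : ∃ n : ℤ, t + n * P ∈ Set.Icc 0 P := by
  refine ⟨-⌊t / P⌋, ?_⟩
  have h1 := Int.floor_le (t / P)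
  have h2 := (Int.lt_floor_add_one (t / P)).le
  rw [le_div_iff₀ hP] at h1
  rw [div_le_iff₀ hP] at h2
  push_cast
  constructor <;> nlinarith

lemma Par.unique {a b P X Y} (hp : Par a b P X Y) (X' Y' : ℝ → ℝ)
    (hpos : ∀ t, 0 < X' t) (hon : ∀ t, FF a b (X' t) (Y' t) = 0)
    (dX : ∀ t, HasDerivAt X' (FY a b (X' t) (Y' t)) t)
    (dY : ∀ t, HasDerivAt Y' (-FX a b (X' t) (Y' t)) t) :
    ∃ c, ∀ t, X' t = X (t + c) ∧ Y' t = Y (t + c) := by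
  obtain ⟨c, hc1, hc2⟩ := hp.surj _ _ (hpos 0) (hon 0)
  set S : Set (ℝ × ℝ) := (fun t => (X t, Y t)) '' Set.Icc 0 P with hS
  have hSc : IsCompact S := isCompact_Icc.image (hp.contX.prodMk hp.contY)
  have hmem : ∀ t, (X t, Y t) ∈ S := by
    intro t
    obtain ⟨n, hn⟩ := exists_Icc_rep hp.Ppos t
    exact ⟨_, hn, by simp only [hp.perXn, hp.perYn]⟩
  set V : ℝ × ℝ → ℝ × ℝ := fun q => (FY a b q.1 q.2, -FX a b q.1 q.2) with hV
  have hVd : ContDiff ℝ 1 V := by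
    simp only [hV, FY, FX]; fun_prop
  obtain ⟨K, hK⟩ := (hVd.locallyLipschitz.locallyLipschitzOn (s := S)).exists_lipschitzOnWith_of_compact hSc
  have := ODE_solution_unique_univ (v := fun _ => V) (s := fun _ => S) (K := K) (t₀ := 0)
    (f := fun t => (X' t, Y' t)) (g := fun t => (X (t + c), Y (t + c))) (fun _ => hK)
    (fun t => ⟨(dX t).prodMk (dY t), by
      obtain ⟨u, hu1, hu2⟩ := hp.surj _ _ (hpos t) (hon t)
      simp only [← hu1, ← hu2]; exact hmem u⟩)
    (fun t => ⟨((hp.dX (t + c)).comp_add_const t c).prodMk ((hp.dY (t + c)).comp_add_const t c),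
      hmem _⟩) (by simp [hc1, hc2])
  refine ⟨c, fun t => ?_⟩
  have := congrFun this t
  simpa using this

lemma Par.inv1 {a b P X Y} (ha : 0 < a) (hp : Par a b P X Y) :
    ∃ c, ∀ t, X (c - t) = X t ∧ Y (c - t) = -2 * b * X t / (X t ^ 2 + a) - Y t := by
  obtain ⟨c, hc⟩ := hp.unique (fun t => X (-t))
    (fun t => -2 * b * X (-t) / (X (-t) ^ 2 + a) - Y (-t)) (fun t => hp.pos _)
    (fun t => by
      have h := hp.on (-t)
      generalize X (-t) = x at *
      generalize Y (-t) = y at *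
      have : x ^ 2 + a ≠ 0 := by positivity
      simp only [FF] at *
      field_simp
      linear_combination (x ^ 2 + a) ^ 2 * h)
    (fun t => by
      have := (hp.dX (-t)).scomp t (hasDerivAt_neg t)
      refine HasDerivAt.congr_deriv this ?_
      generalize X (-t) = x at *
      generalize Y (-t) = y at *
      have : x ^ 2 + a ≠ 0 := by positivity
      simp only [FY, smul_eq_mul]
      field_simp
      ring)
    (fun t => by
      have h1 := (hp.dX (-t)).scomp t (hasDerivAt_neg t)
      have h2 := (hp.dY (-t)).scomp t (hasDerivAt_neg t)
      have hne : X (-t) ^ 2 + a ≠ 0 := by positivity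
      have := ((h1.const_mul (-2 * b)).div ((h1.pow 2).add_const a) hne).sub h2
      refine HasDerivAt.congr_deriv this ?_
      simp only [Function.comp, Pi.pow_apply]
      generalize X (-t) = x at *
      generalize Y (-t) = y at *
      simp only [FY, FX, smul_eq_mul]
      field_simp
      ring)
  refine ⟨c, fun t => ?_⟩
  have := hc (-t)
  simp only [neg_neg] at this
  rw [show c - t = -t + c by ring, ← this.1, ← this.2]
  simp

lemma Par.inv2 {a b P X Y} (ha : 0 < a) (hp : Par a b P X Y) :
    ∃ c, ∀ t, X (c - t) = -2 * b * Y t / (Y t ^ 2 + a) - X t ∧ Y (c - t) = Y t := by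
  obtain ⟨c, hc⟩ := hp.unique
    (fun t => -2 * b * Y (-t) / (Y (-t) ^ 2 + a) - X (-t)) (fun t => Y (-t))
    (fun t => by
      have h := hp.on (-t)
      have hx := hp.pos (-t)
      generalize X (-t) = x at *
      generalize Y (-t) = y at *
      have h0 : y ^ 2 + a ≠ 0 := by positivity
      have : -2 * b * y / (y ^ 2 + a) - x = (1 + a * y ^ 2) / ((y ^ 2 + a) * x) := by
        simp only [FF] at h
        field_simp
        linear_combination - h
      rw [this]
      positivity)
    (fun t => by
      have h := hp.on (-t)
      generalize X (-t) = x at *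
      generalize Y (-t) = y at *
      have : y ^ 2 + a ≠ 0 := by positivity
      simp only [FF] at *
      field_simp
      linear_combination (y ^ 2 + a) ^ 2 * h)
    (fun t => by
      have h1 := (hp.dX (-t)).scomp t (hasDerivAt_neg t)
      have h2 := (hp.dY (-t)).scomp t (hasDerivAt_neg t)
      have hne : Y (-t) ^ 2 + a ≠ 0 := by positivity
      have := ((h2.const_mul (-2 * b)).div ((h2.pow 2).add_const a) hne).sub h1
      refine HasDerivAt.congr_deriv this ?_
      simp only [Function.comp, Pi.pow_apply]
      generalize X (-t) = x at *
      generalize Y (-t) = y at *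
      simp only [FY, FX, smul_eq_mul]
      field_simp
      ring)
    (fun t => by
      have := (hp.dY (-t)).scomp t (hasDerivAt_neg t)
      refine HasDerivAt.congr_deriv this ?_
      generalize X (-t) = x at *
      generalize Y (-t) = y at *
      have : y ^ 2 + a ≠ 0 := by positivity
      simp only [FX, smul_eq_mul]
      field_simp
      ring)
  refine ⟨c, fun t => ?_⟩
  have := hc (-t)
  simp only [neg_neg] at this
  rw [show c - t = -t + c by ring, ← this.1, ← this.2]
  simp



lemma mem_EB {a b x y : ℝ} : (x, y) ∈ EBcurve a b ↔ FF a b x y = 0 := Iff.rfl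

lemma FF_neg (a b x y : ℝ) : FF a b (-x) (-y) = FF a b x y := by simp only [FF]; ring

lemma FF_ne_x {a b x y : ℝ} (ha : 0 < a) (h : FF a b x y ≤ 0) : x ≠ 0 := by
  rintro rfl
  simp only [FF] at h
  nlinarith [sq_nonneg y, mul_nonneg ha.le (sq_nonneg y)]

lemma john_neg (a b : ℝ) (p : ℝ × ℝ) : johnMap a b (-p) = -johnMap a b p := by
  simp only [johnMap, Function.comp, Prod.fst_neg, Prod.snd_neg, Prod.neg_mk, Prod.mk.injEq]
  have h1 : -2 * b * -p.1 / ((-p.1) ^ 2 + a) - -p.2 = -(-2 * b * p.1 / (p.1 ^ 2 + a) - p.2) := by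
    rw [neg_sq]; ring
  rw [h1]
  refine ⟨?_, rfl⟩
  rw [neg_sq]; ring

lemma john_iter_neg (a b : ℝ) (N : ℕ) (p : ℝ × ℝ) :
    (johnMap a b)^[N] (-p) = -(johnMap a b)^[N] p := by
  induction N generalizing p with
  | zero => rfl
  | succ k ih => rw [Function.iterate_succ_apply, Function.iterate_succ_apply, john_neg, ih]

lemma john_iter {a b P X Y c1 c2} (hp : Par a b P X Y)
    (h1 : ∀ t, X (c1 - t) = X t ∧ Y (c1 - t) = -2 * b * X t / (X t ^ 2 + a) - Y t)
    (h2 : ∀ t, X (c2 - t) = -2 * b * Y t / (Y t ^ 2 + a) - X t ∧ Y (c2 - t) = Y t)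
    (N : ℕ) (t : ℝ) :
    (johnMap a b)^[N] (X t, Y t) = (X (t + N * (c2 - c1)), Y (t + N * (c2 - c1))) := by
  induction N generalizing t with
  | zero => simp
  | succ k ih =>
    rw [Function.iterate_succ_apply]
    have : johnMap a b (X t, Y t) = (X (t + (c2 - c1)), Y (t + (c2 - c1))) := by
      have e : t + (c2 - c1) = c2 - (c1 - t) := by ring
      rw [e, (h2 _).1, (h2 _).2, (h1 t).1, (h1 t).2]
      rfl
    rw [this, ih]
    push_cast
    rw [show t + (c2 - c1) + k * (c2 - c1) = t + (k + 1) * (c2 - c1) by ring]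

lemma periodic_iff {a b P X Y c1 c2} (ha : 0 < a) (hp : Par a b P X Y)
    (h1 : ∀ t, X (c1 - t) = X t ∧ Y (c1 - t) = -2 * b * X t / (X t ^ 2 + a) - Y t)
    (h2 : ∀ t, X (c2 - t) = -2 * b * Y t / (Y t ^ 2 + a) - X t ∧ Y (c2 - t) = Y t) :
    (∃ N : ℕ, 1 ≤ N ∧ ∀ p ∈ EBcurve a b, (johnMap a b)^[N] p = p) ↔
      ∃ N : ℕ, 1 ≤ N ∧ ∃ n : ℤ, N * (c2 - c1) = n * P := by
  constructor
  · rintro ⟨N, hN, h⟩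
    refine ⟨N, hN, ?_⟩
    have := h (X 0, Y 0) (hp.on 0)
    rw [john_iter hp h1 h2] at this
    obtain ⟨n, hn⟩ := hp.inj _ _ (congrArg Prod.fst this) (congrArg Prod.snd this)
    exact ⟨n, by linarith⟩
  · rintro ⟨N, hN, n, hn⟩
    refine ⟨N, hN, ?_⟩
    have key : ∀ x y, 0 < x → FF a b x y = 0 → (johnMap a b)^[N] (x, y) = (x, y) := by
      intro x y hx hF
      obtain ⟨t, rfl, rfl⟩ := hp.surj x y hx hF
      rw [john_iter hp h1 h2, hn, hp.perXn, hp.perYn]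
    rintro ⟨x, y⟩ hxy
    rw [mem_EB] at hxy
    rcases lt_or_gt_of_ne (FF_ne_x ha hxy.le) with h | h
    · have := key (-x) (-y) (by linarith) (by rw [FF_neg, hxy])
      have e : ((x, y) : ℝ × ℝ) = -(-x, -y) := by simp
      rw [e, john_iter_neg, this]
    · exact key x y h hxy

lemma path_mem {a b : ℝ} {Om : Set (ℝ × ℝ)} (hop : IsOpen Om) (hfr : frontier Om = EBcurve a b)
    (u v : ℝ) (g : ℝ → ℝ × ℝ) (hg : ContinuousOn g (Set.uIcc u v))
    (hne : ∀ s ∈ Set.uIcc u v, FF a b (g s).1 (g s).2 ≠ 0) (hu : g u ∈ Om) : g v ∈ Om := by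
  have hpre : IsPreconnected (g '' Set.uIcc u v) := isPreconnected_uIcc.image g hg
  refine hpre.subset_of_closure_inter_subset hop ⟨g u, ⟨u, Set.left_mem_uIcc, rfl⟩, hu⟩ ?_
    ⟨v, Set.right_mem_uIcc, rfl⟩
  rintro q ⟨hq, s, hs, rfl⟩
  by_contra hnot
  have : g s ∈ frontier Om := by rw [hop.frontier_eq]; exact ⟨hq, hnot⟩
  rw [hfr] at this
  exact hne s hs this

lemma FF_cont (a b : ℝ) : Continuous (fun p : ℝ × ℝ => FF a b p.1 p.2) := by
  simp only [FF]; fun_prop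

lemma omega_neg {a b : ℝ} (ha : 0 < a) {Om : Set (ℝ × ℝ)} (hop : IsOpen Om)
    (hbd : Bornology.IsBounded Om) (hfr : frontier Om = EBcurve a b) {x y : ℝ}
    (hm : (x, y) ∈ Om) : FF a b x y < 0 := by
  obtain ⟨R, hR⟩ := isBounded_iff_forall_norm_le.1 hbd
  by_contra hcon
  have h0 : FF a b x y ≠ 0 := by
    intro h
    have : (x, y) ∈ frontier Om := by rw [hfr]; exact h
    rw [hop.frontier_eq] at this
    exact this.2 hm
  have hpos : 0 < FF a b x y := lt_of_le_of_ne (not_lt.1 hcon) h0.symm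
  have hzero : (0, 0) ∉ Om := by
    intro h
    have := path_mem hop hfr 0 (|R| + 1) (fun s => (s, 0)) (by fun_prop)
      (fun s _ => by simp only [FF]; nlinarith [mul_nonneg ha.le (sq_nonneg s)]) h
    have := hR _ this
    have h2 := (norm_fst_le ((|R| + 1, 0) : ℝ × ℝ)).trans this
    simp only [Real.norm_eq_abs] at h2
    have := le_abs_self R
    have := le_abs_self (|R| + 1)
    linarith
  by_cases hc : ∃ s ∈ Set.Icc (0:ℝ) 1, FF a b (s * x) (s * y) ≤ 0
  · obtain ⟨s, ⟨hs0, hs1⟩, hs⟩ := hc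
    have hray : ∀ r : ℝ, 1 ≤ r → 0 < FF a b (r * x) (r * y) := by
      intro r hr
      by_contra hr'
      push Not at hr'
      rcases eq_or_lt_of_le hr with h | hr
      · subst h; simp only [one_mul] at hr'; linarith
      have hs1' : s < 1 := by
        rcases eq_or_lt_of_le hs1 with h | h
        · subst h; simp only [one_mul] at hs; linarith
        · exact h
      have hs2 : s ^ 2 < 1 := by nlinarith
      have hr2 : 1 < r ^ 2 := by nlinarith
      have key : (r ^ 2 - s ^ 2) * FF a b x y = (1 - s ^ 2) * FF a b (r * x) (r * y)
          + (r ^ 2 - 1) * FF a b (s * x) (s * y)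
          - (x * y) ^ 2 * ((r ^ 2 - 1) * (1 - s ^ 2) * (r ^ 2 - s ^ 2)) := by
        simp only [FF]; ring
      have e1 : 0 < (r ^ 2 - s ^ 2) * FF a b x y := mul_pos (by linarith) hpos
      have e2 : (1 - s ^ 2) * FF a b (r * x) (r * y) ≤ 0 :=
        mul_nonpos_of_nonneg_of_nonpos (by linarith) hr'
      have e3 : (r ^ 2 - 1) * FF a b (s * x) (s * y) ≤ 0 :=
        mul_nonpos_of_nonneg_of_nonpos (by linarith) hs
      have e4 : 0 ≤ (x * y) ^ 2 * ((r ^ 2 - 1) * (1 - s ^ 2) * (r ^ 2 - s ^ 2)) := by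
        refine mul_nonneg (sq_nonneg _) (mul_nonneg (mul_nonneg ?_ ?_) ?_) <;> linarith
      linarith
    have hx : x ≠ 0 := by
      intro h
      have := FF_ne_x ha hs
      simp [h] at this
    have hx' : 0 < |x| := abs_pos.2 hx
    set r := 1 + (|R| + 1) / |x| with hr
    have hr1 : 1 ≤ r := by rw [hr]; have : 0 ≤ (|R| + 1) / |x| := by positivity
                           linarith
    have := path_mem hop hfr 1 r (fun s => (s * x, s * y)) (by fun_prop)
      (fun s hs => by
        rw [Set.uIcc_of_le hr1] at hs
        exact (hray s hs.1).ne') (by simpa using hm)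
    have := hR _ this
    have h2 := (norm_fst_le ((r * x, r * y) : ℝ × ℝ)).trans this
    simp only [Real.norm_eq_abs, abs_mul] at h2
    have h3 := le_abs_self R
    have h4 : r ≤ |r| := le_abs_self r
    have h5 : r * |x| = |x| + (|R| + 1) := by rw [hr]; field_simp
    have h6 := mul_le_mul_of_nonneg_right h4 hx'.le
    linarith
  · push Not at hc
    apply hzero
    have := path_mem hop hfr 1 0 (fun s => (s * x, s * y)) (by fun_prop)
      (fun s hs => by
        rw [Set.uIcc_of_ge zero_le_one] at hs
        exact (hc s hs).ne') (by simpa using hm)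
    simpa using this

lemma FF_sq {a b x : ℝ} (ha : 0 < a) (y : ℝ) : FF a b x y =
    (x ^ 2 + a) * (y - (-b * x / (x ^ 2 + a))) ^ 2 + FF a b x (-b * x / (x ^ 2 + a)) := by
  have : x ^ 2 + a ≠ 0 := by positivity
  simp only [FF]
  field_simp
  ring

lemma FF_swap (a b x y : ℝ) : FF a b x y = FF a b y x := by simp only [FF]; ring

lemma FF_mid {a b x y z : ℝ} (ha : 0 < a) (h1 : FF a b x y < 0) (h2 : FF a b x z < 0)
    {s : ℝ} (hs : s ∈ Set.uIcc y z) : FF a b x s < 0 := by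
  wlog hyz : y ≤ z generalizing y z
  · exact this h2 h1 (by rwa [Set.uIcc_comm]) (by linarith)
  rw [Set.uIcc_of_le hyz] at hs
  by_contra hc
  push Not at hc
  have key : (z - y) * FF a b x s = (z - s) * FF a b x y + (s - y) * FF a b x z
      - (x ^ 2 + a) * ((z - s) * (s - y) * (z - y)) := by simp only [FF]; ring
  rcases eq_or_lt_of_le hs.1 with h | h
  · subst h; linarith
  have e1 : 0 ≤ (z - y) * FF a b x s := mul_nonneg (by linarith) hc
  have e2 : (z - s) * FF a b x y ≤ 0 := mul_nonpos_of_nonneg_of_nonpos (by linarith [hs.2]) h1.le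
  have e3 : (s - y) * FF a b x z < 0 := mul_neg_of_pos_of_neg (by linarith) h2
  have e4 : 0 ≤ (x ^ 2 + a) * ((z - s) * (s - y) * (z - y)) := by
    refine mul_nonneg (by positivity) (mul_nonneg (mul_nonneg ?_ ?_) ?_) <;> linarith [hs.1, hs.2]
  linarith

lemma FF_min_neg {a b x y : ℝ} (ha : 0 < a) (h : FF a b x y < 0) :
    FF a b x (-b * x / (x ^ 2 + a)) < 0 := by
  have := FF_sq (b := b) (x := x) ha y
  have : 0 ≤ (x ^ 2 + a) * (y - (-b * x / (x ^ 2 + a))) ^ 2 := by positivity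
  linarith

lemma FF_min_iff {a b x : ℝ} (ha : 0 < a) : FF a b x (-b * x / (x ^ 2 + a)) < 0 ↔
    a * x ^ 4 + (1 + a ^ 2 - b ^ 2) * x ^ 2 + a < 0 := by
  have h0 : 0 < x ^ 2 + a := by positivity
  have : FF a b x (-b * x / (x ^ 2 + a)) =
      (a * x ^ 4 + (1 + a ^ 2 - b ^ 2) * x ^ 2 + a) / (x ^ 2 + a) := by
    simp only [FF]; field_simp; ring
  rw [this, div_neg_iff]
  constructor
  · rintro (h | h)
    · linarith [h.2]
    · exact h.1
  · exact fun h => Or.inr ⟨h, h0⟩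

lemma FF_min_mid {a b x z : ℝ} (ha : 0 < a) (hx : 0 < x) (hz : 0 < z)
    (h1 : FF a b x (-b * x / (x ^ 2 + a)) < 0) (h2 : FF a b z (-b * z / (z ^ 2 + a)) < 0)
    {s : ℝ} (hs : s ∈ Set.uIcc x z) : FF a b s (-b * s / (s ^ 2 + a)) < 0 := by
  wlog hyz : x ≤ z generalizing x z
  · exact this hz hx h2 h1 (by rwa [Set.uIcc_comm]) (by linarith)
  rw [Set.uIcc_of_le hyz] at hs
  rw [FF_min_iff ha] at *
  by_contra hc
  push Not at hc
  rcases eq_or_lt_of_le hs.1 with h | h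
  · subst h; linarith
  have q1 : x ^ 2 < s ^ 2 := by nlinarith
  have q2 : s ^ 2 ≤ z ^ 2 := by nlinarith [hs.2]
  have key : (z ^ 2 - x ^ 2) * (a * s ^ 4 + (1 + a ^ 2 - b ^ 2) * s ^ 2 + a)
    = (z ^ 2 - s ^ 2) * (a * x ^ 4 + (1 + a ^ 2 - b ^ 2) * x ^ 2 + a)
      + (s ^ 2 - x ^ 2) * (a * z ^ 4 + (1 + a ^ 2 - b ^ 2) * z ^ 2 + a)
      - a * ((z ^ 2 - s ^ 2) * (s ^ 2 - x ^ 2) * (z ^ 2 - x ^ 2)) := by ring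
  have e1 : 0 ≤ (z ^ 2 - x ^ 2) * (a * s ^ 4 + (1 + a ^ 2 - b ^ 2) * s ^ 2 + a) :=
    mul_nonneg (by linarith) hc
  have e2 : (z ^ 2 - s ^ 2) * (a * x ^ 4 + (1 + a ^ 2 - b ^ 2) * x ^ 2 + a) ≤ 0 :=
    mul_nonpos_of_nonneg_of_nonpos (by linarith) h1.le
  have e3 : (s ^ 2 - x ^ 2) * (a * z ^ 4 + (1 + a ^ 2 - b ^ 2) * z ^ 2 + a) < 0 :=
    mul_neg_of_pos_of_neg (by linarith) h2
  have e4 : 0 ≤ a * ((z ^ 2 - s ^ 2) * (s ^ 2 - x ^ 2) * (z ^ 2 - x ^ 2)) := by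
    refine mul_nonneg ha.le (mul_nonneg (mul_nonneg ?_ ?_) ?_) <;> linarith
  linarith

lemma mid_cont {a : ℝ} (b : ℝ) (ha : 0 < a) : Continuous (fun x : ℝ => -b * x / (x ^ 2 + a)) := by
  refine Continuous.div (by fun_prop) (by fun_prop) (fun x => ?_)
  positivity

lemma exists_plus {a b P X Y} (ha : 0 < a) (hp : Par a b P X Y) {Om : Set (ℝ × ℝ)}
    (hop : IsOpen Om) (hbd : Bornology.IsBounded Om) (hfr : frontier Om = EBcurve a b) :
    ∃ x y, 0 < x ∧ (x, y) ∈ Om := by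
  have h : (X 0, Y 0) ∈ closure Om := by
    apply frontier_subset_closure; rw [hfr]; exact hp.on 0
  have hop' : IsOpen {p : ℝ × ℝ | 0 < p.1} := isOpen_lt continuous_const continuous_fst
  obtain ⟨⟨x, y⟩, h1, h2⟩ := mem_closure_iff.1 h _ hop' (hp.pos 0)
  exact ⟨x, y, h1, h2⟩

lemma plus_sub {a b P X Y} (ha : 0 < a) (hp : Par a b P X Y) {Om : Set (ℝ × ℝ)}
    (hop : IsOpen Om) (hbd : Bornology.IsBounded Om) (hfr : frontier Om = EBcurve a b)
    {x y : ℝ} (hx : 0 < x) (hF : FF a b x y < 0) : (x, y) ∈ Om := by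
  obtain ⟨u, v, hu, huv⟩ := exists_plus ha hp hop hbd hfr
  have hF0 := omega_neg ha hop hbd hfr huv
  have m0 := FF_min_neg ha hF0
  have m1 := FF_min_neg ha hF
  have s1 := path_mem hop hfr v (-b * u / (u ^ 2 + a)) (fun s => (u, s)) (by fun_prop)
    (fun s hs => (FF_mid ha hF0 m0 hs).ne) huv
  have s2 := path_mem hop hfr u x (fun s => (s, -b * s / (s ^ 2 + a)))
    (continuous_id.prodMk (mid_cont b ha)).continuousOn
    (fun s hs => (FF_min_mid ha hu hx m0 m1 hs).ne) s1
  exact path_mem hop hfr (-b * x / (x ^ 2 + a)) y (fun s => (x, s)) (by fun_prop)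
    (fun s hs => (FF_mid ha m1 hF hs).ne) s2

lemma closure_le {a b : ℝ} (ha : 0 < a) {Om : Set (ℝ × ℝ)} (hop : IsOpen Om)
    (hbd : Bornology.IsBounded Om) (hfr : frontier Om = EBcurve a b) {p : ℝ × ℝ}
    (hm : p ∈ closure Om) : FF a b p.1 p.2 ≤ 0 := by
  have hc : IsClosed {p : ℝ × ℝ | FF a b p.1 p.2 ≤ 0} := isClosed_le (FF_cont a b) continuous_const
  exact closure_minimal (fun q hq => (omega_neg ha hop hbd hfr (x := q.1) (y := q.2) hq).le) hc hm


/-- Midpoint of the vertical chord of the region. -/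
noncomputable def md (a b x : ℝ) : ℝ := -b * x / (x ^ 2 + a)

lemma md_cont {a : ℝ} (b : ℝ) (ha : 0 < a) : Continuous (md a b) := mid_cont b ha

/-- Projection of the region to the `x`-axis. -/
def setI (a b : ℝ) : Set ℝ := {x | 0 < x ∧ FF a b x (md a b x) < 0}
/-- Projection of the region to the `y`-axis. -/
def setJ (a b : ℝ) : Set ℝ := {y | b * y < 0 ∧ FF a b (md a b y) y < 0}

lemma setI_open {a : ℝ} (b : ℝ) (ha : 0 < a) : IsOpen (setI a b) := by
  have h : Continuous (fun x => FF a b x (md a b x)) :=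
    (FF_cont a b).comp (continuous_id.prodMk (md_cont b ha))
  exact (isOpen_lt continuous_const continuous_id).inter (isOpen_lt h continuous_const)

lemma setJ_open {a : ℝ} (b : ℝ) (ha : 0 < a) : IsOpen (setJ a b) := by
  have h : Continuous (fun y => FF a b (md a b y) y) :=
    (FF_cont a b).comp ((md_cont b ha).prodMk continuous_id)
  have h' : Continuous (fun y : ℝ => b * y) := by fun_prop
  exact (isOpen_lt h' continuous_const).inter (isOpen_lt h continuous_const)

lemma setJ_ord {a b : ℝ} (ha : 0 < a) {y z s : ℝ} (hy : y ∈ setJ a b) (hz : z ∈ setJ a b)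
    (hs : s ∈ Set.uIcc y z) : s ∈ setJ a b := by
  have hbs : b * s < 0 := by
    rw [Set.mem_uIcc] at hs
    rcases lt_or_ge b 0 with h | h
    · have := pos_of_mul_neg_right hy.1 h.le
      have := pos_of_mul_neg_right hz.1 h.le
      exact mul_neg_of_neg_of_pos h (by rcases hs with hs | hs <;> linarith)
    · have h' : 0 < b := lt_of_le_of_ne h (by rintro rfl; have := hy.1; simp at this)
      have := neg_of_mul_neg_right hy.1 h
      have := neg_of_mul_neg_right hz.1 h
      exact mul_neg_of_pos_of_neg h' (by rcases hs with hs | hs <;> linarith)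
  have h1 := hy.2
  have h2 := hz.2
  refine ⟨hbs, ?_⟩
  rw [FF_swap] at *
  rcases lt_or_ge b 0 with h | h
  · exact FF_min_mid ha (pos_of_mul_neg_right hy.1 h.le) (pos_of_mul_neg_right hz.1 h.le) h1 h2 hs
  · have e : ∀ u, md a b (-u) = - md a b u := fun u => by simp only [md, neg_sq]; ring
    have := FF_min_mid (b := b) (x := -y) (z := -z) (s := -s) ha
      (neg_pos.2 (neg_of_mul_neg_right hy.1 h)) (neg_pos.2 (neg_of_mul_neg_right hz.1 h))
      (by change FF a b (-y) (md a b (-y)) < 0; rw [e, FF_neg]; exact h1)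
      (by change FF a b (-z) (md a b (-z)) < 0; rw [e, FF_neg]; exact h2)
      (by rw [Set.mem_uIcc] at *; rcases hs with hs | hs
          · right; constructor <;> linarith
          · left; constructor <;> linarith)
    change FF a b (-s) (md a b (-s)) < 0 at this
    rwa [e, FF_neg] at this

lemma mem_I {a b x y : ℝ} (ha : 0 < a) (hx : 0 < x) (h : FF a b x y < 0) : x ∈ setI a b :=
  ⟨hx, FF_min_neg ha h⟩

lemma by_neg {a b x y : ℝ} (ha : 0 < a) (hx : 0 < x) (h : FF a b x y ≤ 0) : b * y < 0 := by
  by_contra hc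
  push Not at hc
  have : 0 ≤ x * (b * y) := mul_nonneg hx.le hc
  simp only [FF] at h
  nlinarith [sq_nonneg (x * y), mul_nonneg ha.le (sq_nonneg x), mul_nonneg ha.le (sq_nonneg y)]

lemma mem_J {a b x y : ℝ} (ha : 0 < a) (hx : 0 < x) (h : FF a b x y < 0) : y ∈ setJ a b := by
  refine ⟨by_neg ha hx h.le, ?_⟩
  rw [FF_swap] at *
  exact FF_min_neg ha h

lemma md_pos {a b y : ℝ} (ha : 0 < a) (h : b * y < 0) : 0 < md a b y := by
  simp only [md]
  apply div_pos <;> [linarith; positivity]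

lemma decomp {a b P X Y} (ha : 0 < a) (hp : Par a b P X Y) {Om : Set (ℝ × ℝ)}
    (hop : IsOpen Om) (hbd : Bornology.IsBounded Om) (hfr : frontier Om = EBcurve a b)
    (Φ : ℝ × ℝ → ℝ) (hC : ContDiffOn ℝ 2 Φ Om)
    (hs : ∀ p ∈ Om, deriv (fun x : ℝ => deriv (fun y : ℝ => Φ (x, y)) p.2) p.1 = 0) :
    ∃ f g : ℝ → ℝ, ContinuousOn f (setI a b) ∧ ContinuousOn g (setJ a b) ∧
      ∀ x y, 0 < x → FF a b x y < 0 → Φ (x, y) = f x + g y := by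
  have hD : ∀ x y, 0 < x → FF a b x y < 0 → (x, y) ∈ Om := fun x y hx h =>
    plus_sub ha hp hop hbd hfr hx h
  have hfd : ContDiffOn ℝ 1 (fun q => fderiv ℝ Φ q) Om := hC.fderiv_of_isOpen hop (by norm_num)
  set Q : ℝ × ℝ → ℝ := fun q => fderiv ℝ Φ q (0, 1) with hQ
  have hQd : ContDiffOn ℝ 1 Q Om := hfd.clm_apply contDiffOn_const
  have hQy : ∀ q ∈ Om, HasDerivAt (fun y => Φ (q.1, y)) (Q q) q.2 := by
    intro q hq
    have h1 : HasFDerivAt Φ (fderiv ℝ Φ q) (q.1, q.2) :=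
      ((hC.differentiableOn (by norm_num)).differentiableAt (hop.mem_nhds hq)).hasFDerivAt
    exact h1.comp_hasDerivAt q.2 ((hasDerivAt_const q.2 q.1).prodMk (hasDerivAt_id q.2))
  have hQx : ∀ q ∈ Om, HasDerivAt (fun x => Q (x, q.2)) 0 q.1 := by
    intro q hq
    have hd : DifferentiableAt ℝ (fun x => Q (x, q.2)) q.1 := by
      have h1 : DifferentiableAt ℝ Q (q.1, q.2) :=
        (hQd.differentiableOn (by norm_num)).differentiableAt (hop.mem_nhds hq)
      have h2 : DifferentiableAt ℝ (fun x : ℝ => (x, q.2)) q.1 := by fun_prop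
      exact DifferentiableAt.comp (g := Q) (f := fun x : ℝ => (x, q.2)) q.1 h1 h2
    have hev : (fun x : ℝ => deriv (fun y : ℝ => Φ (x, y)) q.2) =ᶠ[nhds q.1]
        (fun x => Q (x, q.2)) := by
      have hcont : Continuous (fun x : ℝ => (x, q.2)) := by fun_prop
      have := hcont.continuousAt.preimage_mem_nhds (hop.mem_nhds hq : Om ∈ nhds (q.1, q.2))
      filter_upwards [this] with x hx
      exact (hQy (x, q.2) hx).deriv
    have := hs q hq
    rw [hev.deriv_eq] at this
    rw [← this]
    exact hd.hasDerivAt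
  set G : ℝ → ℝ := fun y => Q (md a b y, y) with hG
  have hJm : ∀ y ∈ setJ a b, (md a b y, y) ∈ Om := fun y hy => hD _ _ (md_pos ha hy.1) hy.2
  have hGc : ContinuousOn G (setJ a b) :=
    hQd.continuousOn.comp ((md_cont b ha).prodMk continuous_id).continuousOn hJm
  have hQG : ∀ x y, 0 < x → FF a b x y < 0 → Q (x, y) = G y := by
    intro x y hx h
    have hJ := mem_J ha hx h
    have hopen : IsOpen {s : ℝ | 0 < s ∧ FF a b s y < 0} :=
      (isOpen_lt continuous_const continuous_id).inter
        (isOpen_lt ((FF_cont a b).comp (continuous_id.prodMk continuous_const)) continuous_const)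
    have hpre : IsPreconnected {s : ℝ | 0 < s ∧ FF a b s y < 0} := by
      apply Set.OrdConnected.isPreconnected
      rw [Set.ordConnected_iff_uIcc_subset]
      intro u hu v hv s hs
      refine ⟨?_, ?_⟩
      · rw [Set.mem_uIcc] at hs
        rcases hs with hs | hs
        · exact lt_of_lt_of_le hu.1 hs.1
        · exact lt_of_lt_of_le hv.1 hs.1
      · have h1 := hu.2
        have h2 := hv.2
        rw [FF_swap] at *
        exact FF_mid ha h1 h2 hs
    exact hopen.is_const_of_deriv_eq_zero (f := fun s => Q (s, y)) hpre
      (fun s hs => (hQx (s, y) (hD s y hs.1 hs.2)).differentiableAt.differentiableWithinAt)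
      (fun s hs => (hQx (s, y) (hD s y hs.1 hs.2)).deriv) ⟨hx, h⟩ ⟨md_pos ha hJ.1, hJ.2⟩
  obtain ⟨u, v, hu, huv⟩ := exists_plus ha hp hop hbd hfr
  have hv : v ∈ setJ a b := mem_J ha hu (omega_neg ha hop hbd hfr huv)
  set g : ℝ → ℝ := fun y => ∫ s in v..y, G s with hg
  have hgd : ∀ y ∈ setJ a b, HasDerivAt g (G y) y := by
    intro y hy
    refine intervalIntegral.integral_hasDerivAt_right ?_
      (hGc.stronglyMeasurableAtFilter (setJ_open b ha) y hy)
      (hGc.continuousAt ((setJ_open b ha).mem_nhds hy))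
    exact (hGc.mono (fun s hs => setJ_ord ha hv hy hs)).intervalIntegrable
  have hgc : ContinuousOn g (setJ a b) := fun y hy => (hgd y hy).continuousAt.continuousWithinAt
  refine ⟨fun x => Φ (x, md a b x) - g (md a b x), g, ?_, hgc, ?_⟩
  · refine ContinuousOn.sub ?_ ?_
    · exact hC.continuousOn.comp (continuous_id.prodMk (md_cont b ha)).continuousOn
        (fun x hx => hD _ _ hx.1 hx.2)
    · exact hgc.comp (md_cont b ha).continuousOn (fun x hx => mem_J ha hx.1 hx.2)
  · intro x y hx h
    have hopen : IsOpen {s : ℝ | FF a b x s < 0} :=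
        (isOpen_lt ((FF_cont a b).comp (continuous_const.prodMk continuous_id)) continuous_const)
    have hpre : IsPreconnected {s : ℝ | FF a b x s < 0} := by
      apply Set.OrdConnected.isPreconnected
      rw [Set.ordConnected_iff_uIcc_subset]
      intro u hu v hv s hs
      exact FF_mid ha hu hv hs
    have hder : ∀ s, FF a b x s < 0 → HasDerivAt (fun s => Φ (x, s) - g s) 0 s := by
      intro s hs
      have := (hQy (x, s) (hD x s hx hs)).sub (hgd s (mem_J ha hx hs))
      rw [hQG x s hx hs, sub_self] at this
      exact this
    have := hopen.is_const_of_deriv_eq_zero (f := fun s => Φ (x, s) - g s) hpre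
      (fun s hs => (hder s hs).differentiableAt.differentiableWithinAt)
      (fun s hs => (hder s hs).deriv) h (FF_min_neg ha h)
    change Φ (x, y) - g y = Φ (x, md a b x) - g (md a b x) at this
    simp only
    linarith

lemma boundary {a b P X Y} (ha : 0 < a) (hp : Par a b P X Y) {Om : Set (ℝ × ℝ)}
    (hop : IsOpen Om) (hbd : Bornology.IsBounded Om) (hfr : frontier Om = EBcurve a b)
    (Φ : ℝ × ℝ → ℝ) (hC : ContinuousOn Φ (closure Om)) (h0 : ∀ p ∈ EBcurve a b, Φ p = 0)
    (f g : ℝ → ℝ) (hg : ContinuousOn g (setJ a b))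
    (hfg : ∀ x y, 0 < x → FF a b x y < 0 → Φ (x, y) = f x + g y)
    {x y : ℝ} (hF : FF a b x y = 0) (hx : x ∈ setI a b) (hy : y ∈ setJ a b) : f x + g y = 0 := by
  set r : ℝ → ℝ := fun e => (1 - e) * y + e * md a b x with hr
  have hrc : Continuous r := by simp only [hr]; fun_prop
  have hr0 : r 0 = y := by simp [hr]
  have hmem : ∀ e ∈ Set.Ioo (0:ℝ) 1, FF a b x (r e) < 0 := by
    intro e he
    have key : FF a b x (r e) = (1 - e) * FF a b x y + e * FF a b x (md a b x)
        - (x ^ 2 + a) * (e * (1 - e) * (y - md a b x) ^ 2) := by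
      simp only [hr, FF]; ring
    have e1 : e * FF a b x (md a b x) < 0 := mul_neg_of_pos_of_neg he.1 hx.2
    have e2 : 0 ≤ (x ^ 2 + a) * (e * (1 - e) * (y - md a b x) ^ 2) :=
      mul_nonneg (by positivity) (mul_nonneg (mul_nonneg he.1.le (by linarith [he.2])) (sq_nonneg _))
    rw [key, hF]; linarith
  have hIoo : Set.Ioo (0:ℝ) 1 ∈ nhdsWithin (0:ℝ) (Set.Ioi 0) := Ioo_mem_nhdsGT one_pos
  have t1 : Filter.Tendsto (fun e => Φ (x, r e)) (nhdsWithin 0 (Set.Ioi 0)) (nhds (Φ (x, y))) := by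
    have hcl : (x, y) ∈ closure Om := by apply frontier_subset_closure; rw [hfr]; exact hF
    refine Filter.Tendsto.comp (hC (x, y) hcl) ?_
    refine tendsto_nhdsWithin_iff.2 ⟨?_, ?_⟩
    · have : Continuous (fun e => (x, r e)) := by fun_prop
      have := this.tendsto 0
      rw [hr0] at this
      exact this.mono_left nhdsWithin_le_nhds
    · filter_upwards [hIoo] with e he
      exact subset_closure (plus_sub ha hp hop hbd hfr hx.1 (hmem e he))
  have t2 : Filter.Tendsto (fun e => f x + g (r e)) (nhdsWithin 0 (Set.Ioi 0)) (nhds (f x + g y)) := by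
    refine Filter.Tendsto.const_add _ ?_
    have h1 : ContinuousAt g (r 0) := by
      rw [hr0]; exact hg.continuousAt ((setJ_open b ha).mem_nhds hy)
    have := (h1.comp hrc.continuousAt).tendsto
    simp only [Function.comp, hr0] at this
    exact this.mono_left nhdsWithin_le_nhds
  have t3 : (fun e => Φ (x, r e)) =ᶠ[nhdsWithin 0 (Set.Ioi 0)] (fun e => f x + g (r e)) := by
    filter_upwards [hIoo] with e he
    exact hfg _ _ hx.1 (hmem e he)
  have := tendsto_nhds_unique (t1.congr' t3) t2
  rw [← this]
  exact h0 _ hF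

lemma not_I {a b x y : ℝ} (ha : 0 < a) (hx : 0 < x) (hF : FF a b x y = 0) (h : x ∉ setI a b) :
    y = md a b x := by
  have h1 := FF_sq (b := b) (x := x) ha y
  have h2 : 0 ≤ FF a b x (md a b x) := by
    by_contra hc; exact h ⟨hx, not_le.1 hc⟩
  change _ = (x ^ 2 + a) * (y - md a b x) ^ 2 + FF a b x (md a b x) at h1
  have h0 : 0 < x ^ 2 + a := by positivity
  have h3 : (x ^ 2 + a) * (y - md a b x) ^ 2 ≤ 0 := by linarith
  have h4 : (y - md a b x) ^ 2 ≤ 0 := by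
    by_contra hc
    push Not at hc
    have := mul_pos h0 hc
    linarith
  have := pow_eq_zero_iff (two_ne_zero) |>.1 (le_antisymm h4 (sq_nonneg _))
  linarith

lemma not_J {a b x y : ℝ} (ha : 0 < a) (hx : 0 < x) (hF : FF a b x y = 0) (h : y ∉ setJ a b) :
    x = md a b y := by
  have hb := by_neg ha hx hF.le
  have h1 := FF_sq (b := b) (x := y) ha x
  rw [FF_swap] at hF
  have h2 : 0 ≤ FF a b y (md a b y) := by
    by_contra hc; exact h ⟨hb, by rw [FF_swap]; exact not_le.1 hc⟩
  change _ = (y ^ 2 + a) * (x - md a b y) ^ 2 + FF a b y (md a b y) at h1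
  have h0 : 0 < y ^ 2 + a := by positivity
  have h3 : (y ^ 2 + a) * (x - md a b y) ^ 2 ≤ 0 := by linarith
  have h4 : (x - md a b y) ^ 2 ≤ 0 := by
    by_contra hc
    push Not at hc
    have := mul_pos h0 hc
    linarith
  have := pow_eq_zero_iff (two_ne_zero) |>.1 (le_antisymm h4 (sq_nonneg _))
  linarith

lemma I_or_J {a b x y : ℝ} (ha : 0 < a) (hb : a + 1 < |b|) (hx : 0 < x) (hF : FF a b x y = 0)
    (h : x ∉ setI a b) : y ∈ setJ a b := by
  by_contra hy
  have h1 := not_I ha hx hF h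
  have h2 := not_J ha hx hF hy
  have h0 : x ^ 2 + a ≠ 0 := by positivity
  have h0' : y ^ 2 + a ≠ 0 := by positivity
  simp only [md] at h1 h2
  rw [eq_div_iff h0] at h1
  rw [eq_div_iff h0'] at h2
  have e1 : a * (x ^ 2 - y ^ 2) = 0 := by linear_combination x * h2 - y * h1
  have e2 : y ^ 2 = x ^ 2 := by
    rcases mul_eq_zero.1 e1 with h | h <;> linarith
  have e3 : (x ^ 2 - 1) * (x ^ 2 + 1) = 0 := by
    simp only [FF] at hF
    have : b * x * y = -(x ^ 2 * y ^ 2 + a * y ^ 2) := by linear_combination y * h1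
    linear_combination 2 * this - hF - (x ^ 2 + a) * e2
  have e4 : x ^ 2 = 1 := by
    rcases mul_eq_zero.1 e3 with h | h
    · linarith
    · nlinarith [sq_nonneg x]
  have e5 : b ^ 2 = (1 + a) ^ 2 := by
    have h3 : y * (1 + a) = - b * x := by rw [← h1, e4]
    have : (y * (1 + a)) ^ 2 = (- b * x) ^ 2 := by rw [h3]
    have : y ^ 2 * (1 + a) ^ 2 = b ^ 2 * x ^ 2 := by linear_combination this
    rw [e2, e4] at this
    linarith
  have : |b| = 1 + a := by
    have := (sq_eq_sq_iff_abs_eq_abs _ _).1 e5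
    rwa [abs_of_pos (by linarith : 0 < 1 + a)] at this
  linarith

lemma exists_root {a b x : ℝ} (ha : 0 < a) (h : FF a b x (md a b x) < 0) :
    ∃ y, md a b x < y ∧ FF a b x y = 0 := by
  have h0 : 0 < x ^ 2 + a := by positivity
  have h1 : 0 < -FF a b x (md a b x) / (x ^ 2 + a) := div_pos (by linarith) h0
  refine ⟨md a b x + √(-FF a b x (md a b x) / (x ^ 2 + a)), ?_, ?_⟩
  · have := Real.sqrt_pos.2 h1; linarith
  · rw [FF_sq ha]
    change (x ^ 2 + a) * (md a b x + _ - md a b x) ^ 2 + FF a b x (md a b x) = 0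
    rw [add_sub_cancel_left, Real.sq_sqrt h1.le]
    field_simp
    ring

lemma forward_plus {a b P X Y c1 c2} (ha : 0 < a) (hb : a + 1 < |b|) (hp : Par a b P X Y)
    (h1 : ∀ t, X (c1 - t) = X t ∧ Y (c1 - t) = -2 * b * X t / (X t ^ 2 + a) - Y t)
    (h2 : ∀ t, X (c2 - t) = -2 * b * Y t / (Y t ^ 2 + a) - X t ∧ Y (c2 - t) = Y t)
    (hirr : Irrational ((c2 - c1) / P))
    {Om : Set (ℝ × ℝ)}
    (hop : IsOpen Om) (hbd : Bornology.IsBounded Om) (hfr : frontier Om = EBcurve a b)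
    (Φ : ℝ × ℝ → ℝ) (hsol : IsDirichletSolution a b Om Φ)
    (x y : ℝ) (hx : 0 < x) (hF : FF a b x y < 0) : Φ (x, y) = 0 := by
  classical
  obtain ⟨hC, hC2, hstr, hz⟩ := hsol
  obtain ⟨f, g, hf, hg, hfg⟩ := decomp ha hp hop hbd hfr Φ hC2 hstr
  have hbdy : ∀ t, X t ∈ setI a b → Y t ∈ setJ a b → f (X t) + g (Y t) = 0 := fun t hX hY =>
    boundary ha hp hop hbd hfr Φ hC hz f g hg hfg (hp.on t) hX hY
  set h : ℝ → ℝ := fun t => if X t ∈ setI a b then f (X t) else -g (Y t) with hh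
  have hI : ∀ t, X t ∈ setI a b → h t = f (X t) := fun t ht => by simp only [hh, if_pos ht]
  have hJ : ∀ t, Y t ∈ setJ a b → h t = -g (Y t) := fun t ht => by
    by_cases hX : X t ∈ setI a b
    · rw [hI t hX]; linarith [hbdy t hX ht]
    · simp only [hh, if_neg hX]
  have hcont : Continuous h := by
    rw [continuous_iff_continuousAt]
    intro t
    by_cases hX : X t ∈ setI a b
    · have hn := (setI_open b ha).mem_nhds hX
      have : (fun s => f (X s)) =ᶠ[nhds t] h := by
        filter_upwards [hp.contX.continuousAt.preimage_mem_nhds hn] with s hs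
        exact (hI s hs).symm
      exact ContinuousAt.congr ((hf.continuousAt hn).comp hp.contX.continuousAt) this
    · have hY := I_or_J ha hb (hp.pos t) (hp.on t) hX
      have hn := (setJ_open b ha).mem_nhds hY
      have : (fun s => -g (Y s)) =ᶠ[nhds t] h := by
        filter_upwards [hp.contY.continuousAt.preimage_mem_nhds hn] with s hs
        exact (hJ s hs).symm
      exact ContinuousAt.congr ((hg.continuousAt hn).comp hp.contY.continuousAt).neg this
  have hc1 : ∀ t, h (c1 - t) = h t := by
    intro t
    by_cases hX : X t ∈ setI a b
    · rw [hI t hX, hI _ (by rw [(h1 t).1]; exact hX), (h1 t).1]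
    · have := not_I ha (hp.pos t) (hp.on t) hX
      have hY : Y (c1 - t) = Y t := by
        rw [(h1 t).2, show -2 * b * X t / (X t ^ 2 + a) = 2 * md a b (X t) by simp only [md]; ring,
          ← this]
        ring
      simp only [hh, (h1 t).1, hY]
  have hc2 : ∀ t, h (c2 - t) = h t := by
    intro t
    by_cases hY : Y t ∈ setJ a b
    · rw [hJ t hY, hJ _ (by rw [(h2 t).2]; exact hY), (h2 t).2]
    · have := not_J ha (hp.pos t) (hp.on t) hY
      have hX : X (c2 - t) = X t := by
        rw [(h2 t).1, show -2 * b * Y t / (Y t ^ 2 + a) = 2 * md a b (Y t) by simp only [md]; ring,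
          ← this]
        ring
      simp only [hh, (h2 t).2, hX]
  have hP : ∀ t, h (t + P) = h t := fun t => by simp only [hh, hp.perX, hp.perY]
  have ht : ∀ t, h (t + (c2 - c1)) = h t := by
    intro t
    rw [show t + (c2 - c1) = c2 - (c1 - t) by ring, hc2, hc1]
  have hall : ∀ s ∈ AddSubgroup.closure {c2 - c1, P}, ∀ t, h (t + s) = h t := by
    intro s hs
    induction hs using AddSubgroup.closure_induction with
    | mem x hx =>
      rcases hx with rfl | hx
      · exact ht
      · rw [Set.mem_singleton_iff] at hx; subst hx; exact hP
    | zero => intro t; simp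
    | add x y _ _ hx hy => intro t; rw [← add_assoc, hy, hx]
    | neg x _ hx => intro t; rw [← hx (t + -x)]; simp
  have hdense := dense_addSubgroupClosure_pair_iff.2 hirr
  have hconst : ∀ t, h t = h 0 := by
    have hcl : IsClosed {t | h t = h 0} := isClosed_eq hcont continuous_const
    have hsub : (AddSubgroup.closure {c2 - c1, P} : Set ℝ) ⊆ {t | h t = h 0} := by
      intro s hs
      have := hall s hs 0
      rwa [zero_add] at this
    have := hcl.closure_subset_iff.2 hsub
    rw [hdense.closure_eq] at this
    exact fun t => this (Set.mem_univ t)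
  have hxI := mem_I ha hx hF
  have hyJ := mem_J ha hx hF
  rw [hfg x y hx hF]
  obtain ⟨y1, -, hy1⟩ := exists_root ha hxI.2
  obtain ⟨x1, hx1, hx1'⟩ := exists_root (b := b) (x := y) ha (by rw [FF_swap]; exact hyJ.2)
  obtain ⟨t1, ht1, -⟩ := hp.surj x y1 hx hy1
  obtain ⟨t2, -, ht2⟩ := hp.surj x1 y ((md_pos ha hyJ.1).trans hx1) (by rw [FF_swap]; exact hx1')
  have e1 := hI t1 (by rw [ht1]; exact hxI)
  have e2 := hJ t2 (by rw [ht2]; exact hyJ)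
  rw [hconst, ht1] at e1
  rw [hconst, ht2] at e2
  linarith

lemma forward {a b P X Y c1 c2} (ha : 0 < a) (hb : a + 1 < |b|) (hp : Par a b P X Y)
    (h1 : ∀ t, X (c1 - t) = X t ∧ Y (c1 - t) = -2 * b * X t / (X t ^ 2 + a) - Y t)
    (h2 : ∀ t, X (c2 - t) = -2 * b * Y t / (Y t ^ 2 + a) - X t ∧ Y (c2 - t) = Y t)
    (hirr : Irrational ((c2 - c1) / P))
    {Om : Set (ℝ × ℝ)}
    (hop : IsOpen Om) (hbd : Bornology.IsBounded Om) (hfr : frontier Om = EBcurve a b)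
    (Φ : ℝ × ℝ → ℝ) (hsol : IsDirichletSolution a b Om Φ) :
    ∀ p ∈ closure Om, Φ p = 0 := by
  have hOm : ∀ p ∈ Om, Φ p = 0 := by
    rintro ⟨x, y⟩ hxy
    have hF := omega_neg ha hop hbd hfr hxy
    rcases lt_or_gt_of_ne (FF_ne_x ha hF.le) with hx | hx
    · have hpre : (Homeomorph.neg (ℝ × ℝ)) ⁻¹' Om = {p | -p ∈ Om} := rfl
      have hcl : (Homeomorph.neg (ℝ × ℝ)) ⁻¹' closure Om = closure {p | -p ∈ Om} := by
        rw [← hpre, Homeomorph.preimage_closure]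
      have hop' : IsOpen {p : ℝ × ℝ | -p ∈ Om} := hop.preimage continuous_neg
      have hbd' : Bornology.IsBounded {p : ℝ × ℝ | -p ∈ Om} := by
        obtain ⟨R, hR⟩ := isBounded_iff_forall_norm_le.1 hbd
        exact isBounded_iff_forall_norm_le.2 ⟨R, fun p hp => by
          have := hR _ hp; rwa [norm_neg] at this⟩
      have hfr' : frontier {p : ℝ × ℝ | -p ∈ Om} = EBcurve a b := by
        rw [← hpre, ← Homeomorph.preimage_frontier, hfr]
        ext ⟨u, v⟩
        change FF a b (-u) (-v) = 0 ↔ FF a b u v = 0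
        rw [FF_neg]
      have hsol' : IsDirichletSolution a b {p : ℝ × ℝ | -p ∈ Om} (fun p => Φ (-p)) := by
        obtain ⟨hC, hC2, hstr, hz⟩ := hsol
        refine ⟨?_, ?_, ?_, ?_⟩
        · exact hC.comp continuous_neg.continuousOn (fun p hp => by rw [← hcl] at hp; exact hp)
        · exact hC2.comp contDiff_neg.contDiffOn (fun p hp => hp)
        · intro p hp
          have := hstr (-p) hp
          have e : (fun x : ℝ => deriv (fun y : ℝ => Φ (-(x, y))) p.2) =
              fun x => -((fun x => deriv (fun y : ℝ => Φ (x, y)) (-p.2)) (-x)) := by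
            funext x
            exact deriv_comp_neg (f := fun y => Φ (-x, y)) p.2
          rw [e, deriv.fun_neg, deriv_comp_neg (f := fun x => deriv (fun y : ℝ => Φ (x, y)) (-p.2))]
          simp only [Prod.fst_neg, Prod.snd_neg] at this
          rw [this]; simp
        · rintro ⟨u, v⟩ hp
          apply hz
          change FF a b (-u) (-v) = 0
          rw [FF_neg]; exact hp
      have := forward_plus ha hb hp h1 h2 hirr hop' hbd' hfr' _ hsol' (-x) (-y) (by linarith)
        (by rwa [FF_neg])
      simpa using this
    · exact forward_plus ha hb hp h1 h2 hirr hop hbd hfr Φ hsol x y hx hF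
  have he : Set.EqOn Φ (fun _ => 0) Om := hOm
  exact he.of_subset_closure hsol.1 continuousOn_const subset_closure subset_rfl

lemma descend {X h : ℝ → ℝ} (hd : ∀ s t, X s = X t → h s = h t) :
    ∃ f : ℝ → ℝ, ∀ t, f (X t) = h t := by
  classical
  refine ⟨fun x => if hx : ∃ t, X t = x then h hx.choose else 0, fun t => ?_⟩
  have hx : ∃ s, X s = X t := ⟨t, rfl⟩
  simp only [hx, dif_pos]
  exact hd _ _ hx.choose_spec

lemma descend_cont {X h f : ℝ → ℝ} {P : ℝ} (hX : Continuous X) (hh : Continuous h)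
    (hP : 0 < P) (hper : ∀ (n : ℤ) t, X (t + n * P) = X t) (hf : ∀ t, f (X t) = h t) :
    ContinuousOn f (Set.range X) := by
  rw [continuousOn_iff_isClosed]
  intro S hS
  have hc : IsCompact (Set.Icc 0 P ∩ h ⁻¹' S) := isCompact_Icc.inter_right (hS.preimage hh)
  refine ⟨X '' (Set.Icc 0 P ∩ h ⁻¹' S), (hc.image hX).isClosed, ?_⟩
  ext x
  constructor
  · rintro ⟨hx, t, rfl⟩
    refine ⟨?_, t, rfl⟩
    obtain ⟨n, hn⟩ := exists_Icc_rep hP t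
    refine ⟨t + n * P, ⟨hn, ?_⟩, hper n t⟩
    change h _ ∈ S
    rw [← hf, hper, hf]
    simpa [hf] using hx
  · rintro ⟨⟨t, ⟨_, ht⟩, rfl⟩, hr⟩
    refine ⟨?_, hr⟩
    change f _ ∈ S
    rw [hf]; exact ht

lemma descend_smooth {X h f : ℝ → ℝ} {d t0 : ℝ} (hX : ContDiff ℝ 2 X) (hh : ContDiff ℝ 2 h)
    (hd : HasDerivAt X d t0) (hd0 : d ≠ 0) (hf : ∀ t, f (X t) = h t) :
    ContDiffAt ℝ 2 f (X t0) := by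
  let e : ℝ ≃L[ℝ] ℝ := ContinuousLinearEquiv.unitsEquivAut ℝ (Units.mk0 d hd0)
  have he : HasFDerivAt X (e : ℝ →L[ℝ] ℝ) t0 := by
    have := hd.hasFDerivAt
    have h : (e : ℝ →L[ℝ] ℝ) = ContinuousLinearMap.toSpanSingleton ℝ d := by
      apply ContinuousLinearMap.ext_ring
      simp [e]
    rw [h]
    exact this
  have h2 : (2 : WithTop ℕ∞) ≠ 0 := by norm_num
  have hc := hX.contDiffAt (x := t0)
  have hinv := hc.to_localInverse he h2
  have hs := hc.hasStrictFDerivAt' he h2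
  have hev := hs.eventually_right_inverse
  have hcomp : ContDiffAt ℝ 2 (fun x => h (hc.localInverse he h2 x)) (X t0) :=
    hh.contDiffAt.comp _ hinv
  refine hcomp.congr_of_eventuallyEq ?_
  filter_upwards [hev] with x hx
  rw [← hf]
  congr 1
  exact hx.symm

lemma Par.smooth {a b P X Y} (hp : Par a b P X Y) : ContDiff ℝ 2 X ∧ ContDiff ℝ 2 Y := by
  have dX : deriv X = fun t => FY a b (X t) (Y t) := funext fun t => (hp.dX t).deriv
  have dY : deriv Y = fun t => -FX a b (X t) (Y t) := funext fun t => (hp.dY t).deriv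
  have hdX : Differentiable ℝ X := fun t => (hp.dX t).differentiableAt
  have hdY : Differentiable ℝ Y := fun t => (hp.dY t).differentiableAt
  have step : ∀ n : ℕ, ContDiff ℝ n X ∧ ContDiff ℝ n Y := by
    intro n
    induction n with
    | zero => exact ⟨contDiff_zero.2 hdX.continuous, contDiff_zero.2 hdY.continuous⟩
    | succ n ih =>
      obtain ⟨i1, i2⟩ := ih
      constructor
      · push_cast
        rw [contDiff_succ_iff_deriv]
        refine ⟨hdX, by simp, ?_⟩
        rw [dX]; simp only [FY]; fun_prop
      · push_cast
        rw [contDiff_succ_iff_deriv]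
        refine ⟨hdY, by simp, ?_⟩
        rw [dY]; simp only [FX]; fun_prop
  exact_mod_cast step 2

lemma Par.descX {a b P X Y c1} (ha : 0 < a) (hp : Par a b P X Y)
    (h1 : ∀ t, X (c1 - t) = X t ∧ Y (c1 - t) = -2 * b * X t / (X t ^ 2 + a) - Y t)
    {h : ℝ → ℝ} (hper : ∀ (n : ℤ) t, h (t + n * P) = h t) (hr : ∀ t, h (c1 - t) = h t) :
    ∀ s t, X s = X t → h s = h t := by
  intro s t hst
  have e1 := hp.on s
  have e2 := hp.on t
  rw [hst] at e1
  have h0 : 0 < X t ^ 2 + a := by positivity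
  have key : (Y s - Y t) * ((X t ^ 2 + a) * (Y s + Y t) + 2 * b * X t) = 0 := by
    simp only [FF] at e1 e2; linear_combination e1 - e2
  rcases mul_eq_zero.1 key with hk | hk
  · obtain ⟨n, rfl⟩ := hp.inj s t hst (by linarith)
    exact hper n t
  · have : Y s = Y (c1 - t) := by
      rw [(h1 t).2]; field_simp; linear_combination hk
    obtain ⟨n, rfl⟩ := hp.inj s (c1 - t) (by rw [hst, (h1 t).1]) this
    rw [hper, hr]

lemma Par.descY {a b P X Y c2} (ha : 0 < a) (hp : Par a b P X Y)
    (h2 : ∀ t, X (c2 - t) = -2 * b * Y t / (Y t ^ 2 + a) - X t ∧ Y (c2 - t) = Y t)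
    {h : ℝ → ℝ} (hper : ∀ (n : ℤ) t, h (t + n * P) = h t) (hr : ∀ t, h (c2 - t) = h t) :
    ∀ s t, Y s = Y t → h s = h t := by
  intro s t hst
  have e1 := hp.on s
  have e2 := hp.on t
  rw [hst] at e1
  have h0 : 0 < Y t ^ 2 + a := by positivity
  have key : (X s - X t) * ((Y t ^ 2 + a) * (X s + X t) + 2 * b * Y t) = 0 := by
    simp only [FF] at e1 e2; linear_combination e1 - e2
  rcases mul_eq_zero.1 key with hk | hk
  · obtain ⟨n, rfl⟩ := hp.inj s t (by linarith) hst
    exact hper n t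
  · have : X s = X (c2 - t) := by
      rw [(h2 t).1]; field_simp; linear_combination hk
    obtain ⟨n, rfl⟩ := hp.inj s (c2 - t) this (by rw [hst, (h2 t).2])
    rw [hper, hr]

lemma cos_not_const {w c t0 : ℝ} (hw : w ≠ 0) {k : ℝ} :
    ¬ ∀ᶠ t in nhds t0, Real.cos (w * (t - c)) = k := by
  intro h
  have hd : ∀ t, HasDerivAt (fun t => Real.cos (w * (t - c))) (-Real.sin (w * (t - c)) * w) t := by
    intro t
    have : HasDerivAt (fun t => w * (t - c)) w t := by
      simpa using ((hasDerivAt_id t).sub_const c).const_mul w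
    exact this.cos
  have hs : ∀ᶠ t in nhds t0, Real.sin (w * (t - c)) = 0 := by
    filter_upwards [h.eventually_nhds] with t ht
    have h1 : HasDerivAt (fun t => Real.cos (w * (t - c))) 0 t :=
      (hasDerivAt_const t k).congr_of_eventuallyEq ht
    have := (hd t).unique h1
    rcases mul_eq_zero.1 this with h | h
    · linarith
    · exact absurd h hw
  have h3 : HasDerivAt (fun t => Real.sin (w * (t - c))) (Real.cos (w * (t0 - c)) * w) t0 := by
    have : HasDerivAt (fun t => w * (t - c)) w t0 := by
      simpa using ((hasDerivAt_id t0).sub_const c).const_mul w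
    exact this.sin
  have h4 : HasDerivAt (fun t => Real.sin (w * (t - c))) 0 t0 :=
    (hasDerivAt_const t0 (0:ℝ)).congr_of_eventuallyEq hs
  have h5 := h3.unique h4
  have h6 := hs.self_of_nhds
  rcases mul_eq_zero.1 h5 with h | h
  · have := Real.sin_sq_add_cos_sq (w * (t0 - c))
    rw [h, h6] at this; norm_num at this
  · exact hw h

lemma exists_tX {a b P X Y} (ha : 0 < a) (hp : Par a b P X Y) {x y : ℝ} (hx : 0 < x)
    (hF : FF a b x y < 0) : ∃ t, X t = x ∧ FY a b (X t) (Y t) ≠ 0 := by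
  obtain ⟨y1, h1, h2⟩ := exists_root ha (mem_I ha hx hF).2
  obtain ⟨t, rfl, rfl⟩ := hp.surj x y1 hx h2
  refine ⟨t, rfl, ?_⟩
  have h0 : 0 < X t ^ 2 + a := by positivity
  simp only [md, div_lt_iff₀ h0] at h1
  simp only [FY]
  apply ne_of_gt
  linarith

lemma exists_tY {a b P X Y} (ha : 0 < a) (hp : Par a b P X Y) {x y : ℝ} (hx : 0 < x)
    (hF : FF a b x y < 0) : ∃ t, Y t = y ∧ -FX a b (X t) (Y t) ≠ 0 := by
  have hJ := mem_J ha hx hF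
  have hq := hJ.2
  rw [FF_swap] at hq
  obtain ⟨x1, h1, h2⟩ := exists_root ha hq
  rw [FF_swap] at h2
  obtain ⟨t, rfl, rfl⟩ := hp.surj x1 y ((md_pos ha hJ.1).trans h1) h2
  refine ⟨t, rfl, ?_⟩
  have h0 : 0 < Y t ^ 2 + a := by positivity
  simp only [md, div_lt_iff₀ h0] at h1
  simp only [FX]
  apply ne_of_lt
  linarith

lemma range_le {a b P X Y} (ha : 0 < a) (hp : Par a b P X Y) {x y : ℝ} (hx : 0 < x)
    (hF : FF a b x y ≤ 0) : x ∈ Set.range X ∧ y ∈ Set.range Y := by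
  rcases hF.lt_or_eq with h | h
  · obtain ⟨t, ht, _⟩ := exists_tX ha hp hx h
    obtain ⟨s, hs, _⟩ := exists_tY ha hp hx h
    exact ⟨⟨t, ht⟩, ⟨s, hs⟩⟩
  · obtain ⟨t, ht, hs⟩ := hp.surj x y hx h
    exact ⟨⟨t, ht⟩, ⟨t, hs⟩⟩

lemma backward {a b P X Y c1 c2} (ha : 0 < a) (hp : Par a b P X Y)
    (h1 : ∀ t, X (c1 - t) = X t ∧ Y (c1 - t) = -2 * b * X t / (X t ^ 2 + a) - Y t)
    (h2 : ∀ t, X (c2 - t) = -2 * b * Y t / (Y t ^ 2 + a) - X t ∧ Y (c2 - t) = Y t)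
    {N : ℕ} (hN : 1 ≤ N) {n : ℤ} (hNn : N * (c2 - c1) = n * P)
    {Om : Set (ℝ × ℝ)}
    (hop : IsOpen Om) (hbd : Bornology.IsBounded Om) (hfr : frontier Om = EBcurve a b) :
    ∃ Φ : ℝ × ℝ → ℝ, IsDirichletSolution a b Om Φ ∧ ∃ p ∈ closure Om, Φ p ≠ 0 := by
  have hP := hp.Ppos
  have hN0 : (N : ℝ) ≠ 0 := by exact_mod_cast (by omega : N ≠ 0)
  set w : ℝ := 2 * Real.pi * N / P with hw
  have hw0 : w ≠ 0 := by rw [hw]; have := Real.pi_ne_zero; positivity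
  set h : ℝ → ℝ := fun t => Real.cos (w * (t - c1 / 2)) with hh
  have hsm : ContDiff ℝ 2 h := by
    rw [hh]; exact Real.contDiff_cos.comp (by fun_prop)
  have hper : ∀ (m : ℤ) t, h (t + m * P) = h t := by
    intro m t
    simp only [hh]
    rw [← Real.cos_add_int_mul_two_pi (w * (t - c1 / 2)) (m * N)]
    congr 1
    rw [hw]; push_cast; field_simp; ring
  have hr1 : ∀ t, h (c1 - t) = h t := by
    intro t
    simp only [hh]
    rw [← Real.cos_neg]
    congr 1; ring
  have hr2 : ∀ t, h (c2 - t) = h t := by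
    intro t
    rw [← hr1 t]
    simp only [hh]
    rw [← Real.cos_add_int_mul_two_pi (w * (c1 - t - c1 / 2)) n]
    congr 1
    rw [hw]; field_simp
    linear_combination 2 * hNn
  obtain ⟨f, hf⟩ := descend (hp.descX ha h1 hper hr1)
  obtain ⟨g, hg⟩ := descend (hp.descY ha h2 hper hr2)
  obtain ⟨sX, sY⟩ := hp.smooth
  have cf := descend_cont hp.contX hsm.continuous hP hp.perXn hf
  have cg := descend_cont hp.contY hsm.continuous hP hp.perYn hg
  have smf : ∀ x y, 0 < x → FF a b x y < 0 → ContDiffAt ℝ 2 f x := by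
    intro x y hx hF
    obtain ⟨t, rfl, ht⟩ := exists_tX ha hp hx hF
    exact descend_smooth sX hsm (hp.dX t) ht hf
  have smg : ∀ x y, 0 < x → FF a b x y < 0 → ContDiffAt ℝ 2 g y := by
    intro x y hx hF
    obtain ⟨t, rfl, ht⟩ := exists_tY ha hp hx hF
    exact descend_smooth sY hsm (hp.dY t) ht hg
  let Φ : ℝ × ℝ → ℝ := fun p => if 0 < p.1 then f p.1 - g p.2 else 0
  have Φpos : ∀ x y, 0 < x → Φ (x, y) = f x - g y := fun x y hx => by simp [Φ, hx]
  have Φneg : ∀ x y, x < 0 → Φ (x, y) = 0 := fun x y hx => by simp [Φ, hx.le]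
  have evpos : ∀ p : ℝ × ℝ, 0 < p.1 → Φ =ᶠ[nhds p] fun q => f q.1 - g q.2 := by
    intro p hp'
    filter_upwards [(isOpen_lt continuous_const continuous_fst).mem_nhds hp'] with q hq
    exact Φpos q.1 q.2 hq
  have evneg : ∀ p : ℝ × ℝ, p.1 < 0 → Φ =ᶠ[nhds p] fun q => 0 := by
    intro p hp'
    filter_upwards [(isOpen_lt continuous_fst continuous_const).mem_nhds hp'] with q hq
    exact Φneg q.1 q.2 hq
  refine ⟨Φ, ⟨?_, ?_, ?_, ?_⟩, ?_⟩
  · intro p hpc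
    have hle := closure_le ha hop hbd hfr hpc
    rcases lt_or_gt_of_ne (FF_ne_x ha hle) with hx | hx
    · exact (continuousAt_const.congr (evneg p hx).symm).continuousWithinAt
    · obtain ⟨r1, r2⟩ := range_le ha hp hx hle
      have hO : {q : ℝ × ℝ | 0 < q.1} ∈ nhds p :=
        (isOpen_lt continuous_const continuous_fst).mem_nhds hx
      rw [← continuousWithinAt_inter hO]
      have k1 : ContinuousWithinAt (fun q : ℝ × ℝ => f q.1 - g q.2)
          (closure Om ∩ {q : ℝ × ℝ | 0 < q.1}) p := by
        apply ContinuousWithinAt.sub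
        · refine ContinuousWithinAt.comp (t := Set.range X) (cf _ r1)
            continuous_fst.continuousWithinAt ?_
          rintro q ⟨hq, hq'⟩
          exact (range_le ha hp hq' (closure_le ha hop hbd hfr hq)).1
        · refine ContinuousWithinAt.comp (t := Set.range Y) (cg _ r2)
            continuous_snd.continuousWithinAt ?_
          rintro q ⟨hq, hq'⟩
          exact (range_le ha hp hq' (closure_le ha hop hbd hfr hq)).2
      exact k1.congr (fun q hq => Φpos q.1 q.2 hq.2) (Φpos p.1 p.2 hx)
  · intro p hpm
    have hlt := omega_neg ha hop hbd hfr (x := p.1) (y := p.2) hpm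
    apply ContDiffAt.contDiffWithinAt
    rcases lt_or_gt_of_ne (FF_ne_x ha hlt.le) with hx | hx
    · exact contDiffAt_const.congr_of_eventuallyEq (evneg p hx)
    · refine ContDiffAt.congr_of_eventuallyEq ?_ (evpos p hx)
      exact ((smf p.1 p.2 hx hlt).comp p contDiffAt_fst).sub
        ((smg p.1 p.2 hx hlt).comp p contDiffAt_snd)
  · intro p hpm
    have hlt := omega_neg ha hop hbd hfr (x := p.1) (y := p.2) hpm
    rcases lt_or_gt_of_ne (FF_ne_x ha hlt.le) with hx | hx
    · have : (fun x : ℝ => deriv (fun y : ℝ => Φ (x, y)) p.2) =ᶠ[nhds p.1] fun _ => 0 := by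
        filter_upwards [Iio_mem_nhds hx] with x hx'
        have : (fun y => Φ (x, y)) = fun _ => 0 := funext fun y => Φneg x y hx'
        rw [this]; simp
      rw [this.deriv_eq]; simp
    · have : (fun x : ℝ => deriv (fun y : ℝ => Φ (x, y)) p.2) =ᶠ[nhds p.1]
          fun _ => - deriv g p.2 := by
        filter_upwards [Ioi_mem_nhds hx] with x hx'
        have : (fun y => Φ (x, y)) = fun y => f x - g y := funext fun y => Φpos x y hx'
        rw [this]; simp
      rw [this.deriv_eq]; simp
  · rintro ⟨x, y⟩ hC
    rw [mem_EB] at hC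
    rcases lt_or_gt_of_ne (FF_ne_x ha hC.le) with hx | hx
    · exact Φneg x y hx
    · obtain ⟨t, rfl, rfl⟩ := hp.surj x y hx hC
      rw [Φpos _ _ hx, hf, hg, sub_self]
  · by_contra hcon
    push Not at hcon
    obtain ⟨x0, y0, hx0, hm⟩ := exists_plus ha hp hop hbd hfr
    have hlt := omega_neg ha hop hbd hfr hm
    obtain ⟨t0, rfl, _⟩ := exists_tX ha hp hx0 hlt
    refine cos_not_const (t0 := t0) (c := c1 / 2) (k := g y0) hw0 ?_
    have hct : ContinuousAt (fun t => (X t, y0)) t0 :=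
      (hp.contX.prodMk continuous_const).continuousAt
    filter_upwards [hct.preimage_mem_nhds (hop.mem_nhds hm)] with t ht
    have := hcon _ (subset_closure ht)
    rw [Φpos _ _ (hp.pos t), hf] at this
    simp only [hh] at this
    linarith

/-- (Main theorem.) Assume `a > 0` and `|b| > a + 1`, and let `Ω` be a nonempty
bounded open subset of `ℝ²` whose frontier equals `C`. Then the homogeneous
Dirichlet problem for the string equation on `Ω` has a nontrivial solution iff
the John map `T` is periodic on `C`, i.e. there is `N ≥ 1` with `T^[N] p = p`
for all `p ∈ C`. -/
theorem dirichlet_nontrivial_iff_john_periodic (a b : ℝ) (ha : 0 < a)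
    (hb : a + 1 < |b|) (Ω : Set (ℝ × ℝ)) (hne : Ω.Nonempty) (hop : IsOpen Ω)
    (hbd : Bornology.IsBounded Ω) (hfr : frontier Ω = EBcurve a b) :
    (∃ Φ : ℝ × ℝ → ℝ, IsDirichletSolution a b Ω Φ ∧ ∃ p ∈ closure Ω, Φ p ≠ 0) ↔
      ∃ N : ℕ, 1 ≤ N ∧ ∀ p ∈ EBcurve a b, (johnMap a b)^[N] p = p := by
  obtain ⟨P, X, Y, hp⟩ := exists_par a b ha hb
  obtain ⟨c1, h1⟩ := Par.inv1 ha hp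
  obtain ⟨c2, h2⟩ := Par.inv2 ha hp
  have hP := hp.Ppos
  rw [periodic_iff ha hp h1 h2]
  constructor
  · rintro ⟨Φ, hsol, p, hpc, hne'⟩
    by_contra hno
    refine hne' (forward ha hb hp h1 h2 ?_ hop hbd hfr Φ hsol p hpc)
    rintro ⟨q, hq⟩
    apply hno
    refine ⟨q.den, q.den_pos, q.num, ?_⟩
    have h3 : (q : ℝ) * q.den = q.num := by exact_mod_cast q.mul_den_eq_num
    have h4 : c2 - c1 = q * P := by rw [hq]; field_simp
    rw [h4, ← h3]; ring
  · rintro ⟨N, hN, n, hNn⟩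
    exact backward ha hp h1 h2 hN hNn hop hbd hfr
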